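/- In U_q^{tw}(gl_n), every element s_{ij} with i > j > i′ lies in the F-linear span of products s_{i₁a₁} s_{i₂a₂} ⋯ s_{i_p a_p} in which each factor satisfies a_m′ ≥ i_m > a_m (m = 1,…,p) and the first indices are strictly increasing with i′ < i₁ < i₂ < ⋯ < i_p ≤ j′. -/

import Mathlib

noncomputable section

set_option synthInstance.maxHeartbeats 1000000
set_option maxHeartbeats 1000000

namespace CI

/-- The ground field F = ℂ(q). -/
abbrev F : Type := RatFunc ℂ

/-- The formal variable q. -/
def q : F := RatFunc.X

/-- The index involution i ↦ i′ = 2n+1−i (here in 0-based form i ↦ 2n−1−i). -/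
def pr (n : ℕ) (i : Fin (2*n)) : Fin (2*n) := ⟨2*n - 1 - i.val, by have := i.isLt; omega⟩

/-- ε_i = 1 for i ≤ n and ε_i = −1 for i > n (1-based). -/
def eps (n : ℕ) (i : Fin (2*n)) : F := if (i : ℕ) < n then 1 else -1

/-- (1̄,…,n̄,(n+1)̄,…,(2n)̄) = (n,…,1,−1,…,−n). -/
def bar (n : ℕ) (i : Fin (2*n)) : ℤ :=
  if (i : ℕ) < n then (n : ℤ) - (i : ℕ) else (n : ℤ) - (i : ℕ) - 1

/-- The diagonal entries of D = diag(qⁿ,…,q,q⁻¹,…,q⁻ⁿ): D_{ii} = q^{ī}. -/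
def dd (n : ℕ) (i : Fin (2*n)) : F := q ^ (bar n i)

/-- The entries of the R-matrix R = Σ_{i,j} q^{δ_{ij}−δ_{ij′}} e_{ii} ⊗ e_{jj}
    + (q−q⁻¹) Σ_{i<j} e_{ij} ⊗ e_{ji}
    − (q−q⁻¹) Σ_{i<j} q^{j̄−ī} ε_i ε_j e_{ij} ⊗ e_{i′j′}. -/
def Rm (n : ℕ) (p s : Fin (2*n) × Fin (2*n)) : F :=
  (if p.1 = s.1 ∧ p.2 = s.2 then
      q ^ ((if p.1 = p.2 then (1:ℤ) else 0) - (if p.1 = pr n p.2 then (1:ℤ) else 0)) else 0)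
  + (if p.1 < p.2 ∧ s.1 = p.2 ∧ s.2 = p.1 then q - q⁻¹ else 0)
  - (if p.1 < s.1 ∧ p.2 = pr n p.1 ∧ s.2 = pr n s.1 then
      (q - q⁻¹) * q ^ (bar n s.1 - bar n p.1) * eps n p.1 * eps n s.1 else 0)

/-- Generators t_{ij}, t̄_{ij} of the extended algebra. -/
inductive Gen (n : ℕ) : Type
  | t (i j : Fin (2*n)) : Gen n
  | tb (i j : Fin (2*n)) : Gen n

/-- The free F-algebra on the generators. -/
abbrev FA (n : ℕ) : Type := FreeAlgebra F (Gen n)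

def tF (n : ℕ) (i j : Fin (2*n)) : FA n := FreeAlgebra.ι F (Gen.t i j)
def tbF (n : ℕ) (i j : Fin (2*n)) : FA n := FreeAlgebra.ι F (Gen.tb i j)

/-- The defining relations of the RTT presentation U_q(sp_{2n}): the triangularity
    and diagonal relations, the entrywise RTT relations R T₁ T₂ = T₂ T₁ R,
    R T̄₁ T̄₂ = T̄₂ T̄₁ R, R T̄₁ T₂ = T₂ T̄₁ R, and the entrywise central relations
    T D Tᵗ D⁻¹ = T̄ D T̄ᵗ D⁻¹ = I, D Tᵗ D⁻¹ T = D T̄ᵗ D⁻¹ T̄ = I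
    (where ᵗ is the twisted transposition e_{ij}ᵗ = ε_i ε_j e_{j′i′}). -/
inductive rel (n : ℕ) : FA n → FA n → Prop
  | t_upper (i j : Fin (2*n)) (h : i < j) : rel n (tF n i j) 0
  | tb_lower (i j : Fin (2*n)) (h : j < i) : rel n (tbF n i j) 0
  | t_tb_diag (i : Fin (2*n)) : rel n (tF n i i * tbF n i i) 1
  | tb_t_diag (i : Fin (2*n)) : rel n (tbF n i i * tF n i i) 1
  | rtt_tt (i a j b : Fin (2*n)) :
      rel n (∑ k, ∑ c, Rm n (i, a) (k, c) • (tF n k j * tF n c b))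
            (∑ c, ∑ l, Rm n (l, c) (j, b) • (tF n a c * tF n i l))
  | rtt_bb (i a j b : Fin (2*n)) :
      rel n (∑ k, ∑ c, Rm n (i, a) (k, c) • (tbF n k j * tbF n c b))
            (∑ c, ∑ l, Rm n (l, c) (j, b) • (tbF n a c * tbF n i l))
  | rtt_bt (i a j b : Fin (2*n)) :
      rel n (∑ k, ∑ c, Rm n (i, a) (k, c) • (tbF n k j * tF n c b))
            (∑ c, ∑ l, Rm n (l, c) (j, b) • (tF n a c * tbF n i l))
  | cent_t1 (i j : Fin (2*n)) :
      rel n (∑ k, (dd n k * (dd n j)⁻¹ * eps n (pr n k) * eps n (pr n j)) •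
              (tF n i k * tF n (pr n j) (pr n k)))
            (if i = j then 1 else 0)
  | cent_tb1 (i j : Fin (2*n)) :
      rel n (∑ k, (dd n k * (dd n j)⁻¹ * eps n (pr n k) * eps n (pr n j)) •
              (tbF n i k * tbF n (pr n j) (pr n k)))
            (if i = j then 1 else 0)
  | cent_t2 (i j : Fin (2*n)) :
      rel n (∑ k, (dd n i * (dd n k)⁻¹ * eps n (pr n i) * eps n (pr n k)) •
              (tF n (pr n k) (pr n i) * tF n k j))
            (if i = j then 1 else 0)
  | cent_tb2 (i j : Fin (2*n)) :
      rel n (∑ k, (dd n i * (dd n k)⁻¹ * eps n (pr n i) * eps n (pr n k)) •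
              (tbF n (pr n k) (pr n i) * tbF n k j))
            (if i = j then 1 else 0)

/-- The RTT presentation U_q(sp_{2n}). -/
abbrev Usp (n : ℕ) : Type := RingQuot (rel n)

/-- The generator t_{ij} of U_q(sp_{2n}). -/
def tU (n : ℕ) (i j : Fin (2*n)) : Usp n := RingQuot.mkAlgHom F (rel n) (tF n i j)

/-- The generator t̄_{ij} of U_q(sp_{2n}). -/
def tbU (n : ℕ) (i j : Fin (2*n)) : Usp n := RingQuot.mkAlgHom F (rel n) (tbF n i j)

/-- The entries s_{ij} = Σ_{k=j}^{i} ε_k t_{ik} t̄_{jk} of the matrix S = T J T̄^u. -/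
def sU (n : ℕ) (i j : Fin (2*n)) : Usp n :=
  ∑ k ∈ Finset.Icc j i, eps n k • (tU n i k * tbU n j k)

/-- The entries s̄_{ij} = ε_i ε_j Σ_{k=j}^{i} ε_{k′} t̄_{i′k′} t_{j′k′} of the
    matrix S̄ = T̄^{ut} Jᵗ Tᵗ. -/
def sbU (n : ℕ) (i j : Fin (2*n)) : Usp n :=
  (eps n i * eps n j) • ∑ k ∈ Finset.Icc j i,
    eps n (pr n k) • (tbU n (pr n i) (pr n k) * tU n (pr n j) (pr n k))

/-- The twisted quantized enveloping algebra U_q^{tw}(gl_n): the subalgebra of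
    U_q(sp_{2n}) generated by the entries of S. -/
def Utw (n : ℕ) : Subalgebra F (Usp n) :=
  Algebra.adjoin F (Set.range fun p : Fin (2*n) × Fin (2*n) => sU n p.1 p.2)


/-! ### Auxiliary material: a generic algebra carrying the relations -/

lemma pr_val (n : ℕ) (i : Fin (2*n)) : (pr n i : ℕ) = 2*n - 1 - (i:ℕ) := rfl

lemma pr_pr (n : ℕ) (i : Fin (2*n)) : pr n (pr n i) = i := by
  apply Fin.ext; simp only [pr_val]; have := i.isLt; omega

lemma pr_ne (n : ℕ) (i : Fin (2*n)) : pr n i ≠ i := by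
  intro h; have := congrArg Fin.val h; simp only [pr_val] at this; have := i.isLt; omega

lemma ne_pr (n : ℕ) (i : Fin (2*n)) : i ≠ pr n i := fun h => pr_ne n i h.symm

lemma eps_sq (n : ℕ) (i : Fin (2*n)) : eps n i * eps n i = 1 := by
  unfold eps; split_ifs <;> simp

lemma eps_pr (n : ℕ) (i : Fin (2*n)) : eps n (pr n i) = - eps n i := by
  have := i.isLt
  have h0 := pr_val n i
  by_cases h : (i : ℕ) < n
  · have h' : ¬ ((pr n i : ℕ) < n) := by omega
    rw [eps, eps, if_pos h, if_neg h']
  · have h' : ((pr n i : ℕ) < n) := by omega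
    rw [eps, eps, if_neg h, if_pos h', neg_neg]

lemma bar_pr (n : ℕ) (i : Fin (2*n)) : bar n (pr n i) = - bar n i := by
  unfold bar; simp only [pr_val]; have := i.isLt
  split_ifs <;> omega

lemma q_ne : q ≠ 0 := RatFunc.X_ne_zero

lemma dd_ne (n : ℕ) (i : Fin (2*n)) : dd n i ≠ 0 := zpow_ne_zero _ q_ne

lemma dd_pr (n : ℕ) (i : Fin (2*n)) : dd n (pr n i) = (dd n i)⁻¹ := by
  unfold dd; rw [bar_pr, zpow_neg]

/-- The constant q - q⁻¹. -/
def hq : F := q - q⁻¹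

/-- Diagonal coefficient of the R-matrix. -/
def qd (n : ℕ) (i a : Fin (2*n)) : F :=
  q ^ ((if i = a then (1:ℤ) else 0) - (if i = pr n a then (1:ℤ) else 0))

/-- The third coefficient of the R-matrix. -/
def qc (n : ℕ) (i k : Fin (2*n)) : F :=
  (q - q⁻¹) * q ^ (bar n k - bar n i) * eps n i * eps n k

lemma Rm_eq (n : ℕ) (i a k c : Fin (2*n)) : Rm n (i, a) (k, c) =
    (if i = k ∧ a = c then qd n i a else 0) + (if i < a ∧ k = a ∧ c = i then hq else 0)
     - (if i < k ∧ a = pr n i ∧ c = pr n k then qc n i k else 0) := rfl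

set_option linter.unusedSectionVars false

section generic
variable {n : ℕ} {A : Type*} [Ring A] [Algebra F A]

/-- Explicit form of the action of a row of R. -/
def rowR (f : Fin (2*n) → Fin (2*n) → A) (i a : Fin (2*n)) : A :=
  qd n i a • f i a + (if i < a then hq • f a i else 0)
    - (if a = pr n i then ∑ k, (if i < k then qc n i k • f k (pr n k) else 0) else 0)

/-- Explicit form of the action of a column of R. -/
def colR (f : Fin (2*n) → Fin (2*n) → A) (j b : Fin (2*n)) : A :=
  qd n j b • f j b + (if b < j then hq • f b j else 0)
    - (if b = pr n j then ∑ l, (if l < j then qc n l j • f l (pr n l) else 0) else 0)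

lemma R_row (f : Fin (2*n) → Fin (2*n) → A) (i a : Fin (2*n)) :
    ∑ k, ∑ c, Rm n (i, a) (k, c) • f k c = rowR f i a := by
  simp only [Rm_eq, rowR, sub_smul, add_smul, Finset.sum_sub_distrib, Finset.sum_add_distrib]
  congr 1
  · congr 1
    · simp only [ite_and, ite_smul, zero_smul]
      rw [Finset.sum_eq_single i]
      · simp
      · intro b _ hb; simp [Ne.symm hb]
      · simp
    · split_ifs with h
      · simp [h, ite_and]
      · simp [h]
  · split_ifs with h
    · apply Finset.sum_congr rfl; intro k _
      simp [h, ite_and]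
    · simp [h]

lemma R_col (f : Fin (2*n) → Fin (2*n) → A) (j b : Fin (2*n)) :
    ∑ c, ∑ l, Rm n (l, c) (j, b) • f l c = colR f j b := by
  simp only [Rm_eq, colR, sub_smul, add_smul, Finset.sum_sub_distrib, Finset.sum_add_distrib]
  congr 1
  · congr 1
    · rw [Finset.sum_eq_single b, Finset.sum_eq_single j]
      · simp
      · intro b _ hb; simp [hb]
      · simp
      · intro c _ hb; simp [hb]
      · simp
    · rw [Finset.sum_eq_single j, Finset.sum_eq_single b]
      · simp
      · intro b _ hb; simp [Ne.symm hb]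
      · simp
      · intro c _ hb; simp [Ne.symm hb]
      · simp
  · rw [Finset.sum_comm]
    split_ifs with h
    · apply Finset.sum_congr rfl; intro k _
      simp [h, ite_and]
    · simp [h]

/-- The relations used. -/
structure Dat (t tb : Fin (2*n) → Fin (2*n) → A) : Prop where
  t_upper : ∀ i j, i < j → t i j = 0
  tb_lower : ∀ i j, j < i → tb i j = 0
  diag : ∀ i, t i i * tb i i = 1
  rtt_tt : ∀ i a j b, ∑ k, ∑ c, Rm n (i, a) (k, c) • (t k j * t c b)
            = ∑ c, ∑ l, Rm n (l, c) (j, b) • (t a c * t i l)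
  rtt_bb : ∀ i a j b, ∑ k, ∑ c, Rm n (i, a) (k, c) • (tb k j * tb c b)
            = ∑ c, ∑ l, Rm n (l, c) (j, b) • (tb a c * tb i l)
  rtt_bt : ∀ i a j b, ∑ k, ∑ c, Rm n (i, a) (k, c) • (tb k j * t c b)
            = ∑ c, ∑ l, Rm n (l, c) (j, b) • (t a c * tb i l)
  cent_tb1 : ∀ i j, ∑ k, (dd n k * (dd n j)⁻¹ * eps n (pr n k) * eps n (pr n j)) •
              (tb i k * tb (pr n j) (pr n k)) = if i = j then 1 else 0
  cent_t2 : ∀ i j, ∑ k, (dd n i * (dd n k)⁻¹ * eps n (pr n i) * eps n (pr n k)) •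
              (t (pr n k) (pr n i) * t k j) = if i = j then 1 else 0

/-- The entries of S. -/
def sa (t tb : Fin (2*n) → Fin (2*n) → A) (i j : Fin (2*n)) : A :=
  ∑ k, eps n k • (t i k * tb j k)

/-- The entries of the opposite product. -/
def ma (t tb : Fin (2*n) → Fin (2*n) → A) (i a : Fin (2*n)) : A :=
  ∑ k, eps n k • (tb i k * t a k)

lemma qd_pr (i : Fin (2*n)) : qd n i (pr n i) = q⁻¹ := by
  simp [qd, ne_pr, pr_pr]

lemma qd_self (i : Fin (2*n)) : qd n i i = q := by
  simp [qd, ne_pr]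

lemma qd_gen {i a : Fin (2*n)} (h1 : a ≠ i) (h2 : a ≠ pr n i) : qd n i a = 1 := by
  have h3 : i ≠ pr n a := by rintro rfl; exact h2 (pr_pr n a).symm
  simp [qd, h1.symm, h3]

lemma qc_symm (i a : Fin (2*n)) : qc n (pr n i) a = qc n (pr n a) i := by
  unfold qc; rw [bar_pr, bar_pr, eps_pr, eps_pr, sub_neg_eq_add, sub_neg_eq_add, add_comm]; ring

lemma Rm_anti (l i d : Fin (2*n)) :
    Rm n (l, pr n i) (i, d) = if l = i ∧ d = pr n i then q⁻¹ else 0 := by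
  rw [Rm_eq]
  have e2 : ¬ (l < pr n i ∧ i = pr n i ∧ d = l) := fun h => ne_pr n i h.2.1
  have e3 : ¬ (l < i ∧ pr n i = pr n l ∧ d = pr n i) := by
    rintro ⟨h1, h2, -⟩
    have := congrArg (pr n) h2
    simp only [pr_pr] at this
    exact absurd this h1.ne'
  rw [if_neg e2, if_neg e3, add_zero, sub_zero]
  by_cases h : l = i ∧ d = pr n i
  · rw [if_pos h, if_pos ⟨h.1, h.2.symm⟩, h.1, qd_pr]
  · rw [if_neg h, if_neg (fun h' => h ⟨h'.1, h'.2.symm⟩)]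

lemma Rm_anti2 (l a i : Fin (2*n)) :
    Rm n (l, a) (i, pr n l) = if l = i ∧ a = pr n l then q⁻¹ else 0 := by
  rw [Rm_eq]
  have e2 : ¬ (l < a ∧ i = a ∧ pr n l = l) := fun h => pr_ne n l h.2.2
  have e3 : ¬ (l < i ∧ a = pr n l ∧ pr n l = pr n i) := by
    rintro ⟨h1, -, h2⟩
    have := congrArg (pr n) h2
    simp only [pr_pr] at this
    exact absurd this h1.ne
  rw [if_neg e2, if_neg e3, add_zero, sub_zero]
  by_cases h : l = i ∧ a = pr n l
  · rw [if_pos h, if_pos h, h.2, qd_pr]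
  · rw [if_neg h, if_neg h]

lemma Rm_gen {l a : Fin (2*n)} (i d : Fin (2*n)) (h1 : a ≠ i) :
    Rm n (l, a) (i, d) = (if l = i ∧ a = d then qd n l a else 0)
      - (if l < i ∧ a = pr n l ∧ d = pr n i then qc n l i else 0) := by
  rw [Rm_eq, if_neg (c := l < a ∧ i = a ∧ d = l) (fun h => h1 h.2.1.symm), add_zero]

/-- The scalar reflection equation for J. -/
lemma J_refl (i a j b : Fin (2*n)) :
    rowR (A := F) (fun k c => eps n k * eps n b * Rm n (j, c) (k, b)) i a =
    colR (A := F) (fun l d => eps n a * eps n l * Rm n (l, a) (i, d)) j b := by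
  unfold rowR colR
  simp only [smul_eq_mul]
  by_cases ha : a = pr n i
  · subst ha
    have hf : Rm n (j, i) (pr n i, b) = if j = pr n i ∧ b = i then q⁻¹ else 0 := by
      have := Rm_anti j (pr n i) b
      rwa [pr_pr] at this
    simp only [Rm_anti, qd_pr, if_true, hf]
    by_cases hb : b = pr n j
    · subst hb
      have e1 : ∀ x, (j = x ∧ pr n j = pr n x) ↔ j = x :=
        fun x => ⟨fun h => h.1, fun h => ⟨h, by rw [h]⟩⟩
      have e2 : (j = pr n i ∧ pr n j = i) ↔ j = pr n i :=
        ⟨fun h => h.1, fun h => ⟨h, by rw [h, pr_pr]⟩⟩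
      have e3 : (j = i ∧ pr n j = pr n i) ↔ i = j := by rw [e1, eq_comm]
      have e4 : (pr n j = i ∧ j = pr n i) ↔ j = pr n i := by rw [and_comm, e2]
      have e5 : ∀ x, (x = i ∧ pr n x = pr n i) ↔ x = i :=
        fun x => ⟨fun h => h.1, fun h => ⟨h, by rw [h]⟩⟩
      simp only [e3, e2, e4, e5, e1, qd_pr, if_true]
      have s1 : (∑ k, if i < k then qc n i k * (eps n k * eps n (pr n j) * if j = k then q⁻¹ else 0)
          else 0) = if i < j then - (qc n i j * q⁻¹) else 0 := by
        rw [Finset.sum_eq_single j]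
        · rw [eps_pr]
          split_ifs
          · linear_combination (- qc n i j * q⁻¹) * eps_sq n j
          · contradiction
          · rfl
        · intro b _ hb; simp [Ne.symm hb]
        · simp
      have s2 : (∑ l, if l < j then qc n l j * (eps n (pr n i) * eps n l * if l = i then q⁻¹ else 0)
          else 0) = if i < j then - (qc n i j * q⁻¹) else 0 := by
        rw [Finset.sum_eq_single i]
        · rw [eps_pr]
          split_ifs
          · linear_combination (- qc n i j * q⁻¹) * eps_sq n i
          · contradiction
          · rfl
        · intro b _ hb; simp [hb]
        · simp
      rw [s1, s2]
      congr 1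
      have t1 : (q⁻¹ * (eps n i * eps n (pr n j) * if i = j then q⁻¹ else 0)) =
          q⁻¹ * (eps n (pr n i) * eps n j * if i = j then q⁻¹ else 0) := by
        split_ifs with h
        · subst h; ring
        · simp
      rw [t1]
      congr 1
      by_cases h : j = pr n i
      · subst h
        rw [pr_pr]
      · simp only [if_neg h]
        simp
    · have e1 : ∀ x, ¬ (j = x ∧ b = pr n x) := by rintro x ⟨rfl, h⟩; exact hb h
      have e2 : ¬ (j = pr n i ∧ b = i) := by rintro ⟨rfl, h⟩; rw [pr_pr] at hb; exact hb h
      have e3 : ¬ (b = i ∧ j = pr n i) := fun h => e2 ⟨h.2, h.1⟩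
      simp only [if_neg (e1 _), if_neg e2, if_neg e3, if_neg hb]
      simp
  · have ha' : i ≠ pr n a := fun h => ha (by rw [h, pr_pr])
    rw [if_neg ha, sub_zero]
    by_cases hb : b = pr n j
    · subst hb
      have hf : Rm n (pr n j, a) (i, j) = if pr n j = i ∧ a = j then q⁻¹ else 0 := by
        have := Rm_anti2 (pr n j) a i
        rwa [pr_pr] at this
      have hs : ∀ l, eps n a * eps n l * Rm n (l, a) (i, pr n l) = 0 := by
        intro l
        rw [Rm_anti2, if_neg, mul_zero]
        rintro ⟨rfl, h⟩; exact ha h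
      have e1 : ¬ (j = i ∧ a = pr n j) := by rintro ⟨rfl, h⟩; exact ha h
      have e2 : ¬ (j = a ∧ i = pr n j) := by rintro ⟨rfl, h⟩; exact ha' h
      have e3 : ¬ (pr n j = i ∧ a = j) := by rintro ⟨h, rfl⟩; exact ha' h.symm
      simp only [hs]
      simp only [Rm_anti2, hf, if_neg e1, if_neg e2, if_neg e3]
      simp
    · have hb' : j ≠ pr n b := fun h => hb (by rw [h, pr_pr])
      rw [if_neg hb, sub_zero]
      by_cases hai : a = i
      · subst hai
        simp only [lt_irrefl, if_false, add_zero]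
        by_cases hbj : b = j
        · subst hbj
          simp only [lt_irrefl, if_false, add_zero, qd_self]
        · have z : ∀ l d, l ≠ d → l ≠ pr n d → Rm n (l, a) (a, d) = 0 := by
            intro l d h h'
            rw [Rm_eq, if_neg, if_neg, if_neg]
            · simp
            · rintro ⟨-, rfl, rfl⟩; rw [pr_pr] at h; exact h rfl
            · rintro ⟨-, -, rfl⟩; exact h rfl
            · rintro ⟨rfl, rfl⟩; exact h rfl
          rw [z _ _ (Ne.symm hbj) hb', z _ _ hbj hb]; simp
      · by_cases hbj : b = j
        · subst hbj
          have z : ∀ k c, c ≠ k → c ≠ pr n k → Rm n (b, c) (k, b) = 0 := by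
            intro k c h h'
            rw [Rm_gen _ _ h, if_neg, if_neg, sub_zero]
            · rintro ⟨-, rfl, h3⟩; rw [h3, pr_pr] at h; exact h rfl
            · rintro ⟨rfl, rfl⟩; exact h rfl
          simp only [lt_irrefl, if_false, z _ _ hai ha, z _ _ (Ne.symm hai) ha']
          simp
        · rw [Rm_gen _ _ hai, Rm_gen _ _ (Ne.symm hai), Rm_gen _ _ hai, qd_gen hai ha,
            qd_gen hbj hb]
          have t2 : (if i < a then hq * (eps n a * eps n b * ((if j = a ∧ i = b then qd n j i else 0) -
              if j < a ∧ i = pr n j ∧ b = pr n a then qc n j a else 0)) else 0) =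
              if b < j then hq * (eps n a * eps n b * ((if b = i ∧ a = j then qd n b a else 0) -
              if b < i ∧ a = pr n b ∧ j = pr n i then qc n b i else 0)) else 0 := by
            by_cases h1 : j = a ∧ i = b
            · obtain ⟨rfl, rfl⟩ := h1
              have x1 : ¬ (j < j ∧ i = pr n j ∧ i = pr n j) := fun h => lt_irrefl _ h.1
              have x2 : ¬ (i < i ∧ j = pr n i ∧ j = pr n i) := fun h => lt_irrefl _ h.1
              rw [if_neg x1, if_neg x2, qd_gen hai ha, qd_gen (Ne.symm hai) ha']
              simp only [and_true]
            · rw [if_neg h1, if_neg (fun h : b = i ∧ a = j => h1 ⟨h.2.symm, h.1.symm⟩)]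
              by_cases h2 : i = pr n j ∧ b = pr n a
              · obtain ⟨h2, rfl⟩ := h2
                have h3 : j = pr n i := by rw [h2, pr_pr]
                subst h3
                simp only [pr_pr, and_true]
                rw [qc_symm i a]
                have := i.isLt
                have := a.isLt
                have c1 : pr n a < pr n i ↔ i < a := by
                  simp only [Fin.lt_def, pr_val]; omega
                have c2 : pr n i < a ↔ pr n a < i := by
                  simp only [Fin.lt_def, pr_val]; omega
                simp only [c1, c2]
              · rw [if_neg (c := j < a ∧ i = pr n j ∧ b = pr n a) (fun h => h2 h.2),
                  if_neg (c := b < i ∧ a = pr n b ∧ j = pr n i)]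
                · simp
                · rintro ⟨-, rfl, rfl⟩
                  exact h2 ⟨(pr_pr n _).symm, (pr_pr n _).symm⟩
          rw [t2]
          congr 2
          by_cases h1 : j = i ∧ a = b
          · obtain ⟨rfl, rfl⟩ := h1
            ring
          · rw [if_neg h1]
            by_cases h2 : j < i ∧ a = pr n j ∧ b = pr n i
            · obtain ⟨-, rfl, rfl⟩ := h2
              rw [eps_pr, eps_pr]
              linear_combination (-(if j < i ∧ pr n j = pr n j ∧ pr n i = pr n i then qc n j i else 0)) * (eps_sq n j - eps_sq n i)
            · rw [if_neg h2]; simp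

lemma qd_symm (i a : Fin (2*n)) : qd n i a = qd n a i := by
  have h : i = pr n a ↔ a = pr n i :=
    ⟨fun h => by rw [h, pr_pr], fun h => by rw [h, pr_pr]⟩
  unfold qd
  simp only [h, eq_comm (a := i) (b := a)]

lemma Rm_symm (i a k c : Fin (2*n)) : Rm n (i, a) (k, c) = Rm n (c, k) (a, i) := by
  rw [Rm_eq, Rm_eq]
  congr 1
  · congr 1
    · by_cases h : i = k ∧ a = c
      · rw [if_pos h, if_pos ⟨h.2.symm, h.1.symm⟩, ← h.1, ← h.2, qd_symm]
      · rw [if_neg h, if_neg (fun h' => h ⟨h'.2.symm, h'.1.symm⟩)]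
    · by_cases h : i < a ∧ k = a ∧ c = i
      · obtain ⟨h1, rfl, rfl⟩ := h
        simp
      · rw [if_neg h, if_neg]
        rintro ⟨h1, rfl, rfl⟩
        exact h ⟨h1, rfl, rfl⟩
  · have key : ∀ x y : Fin (2*n), x < y → pr n y < pr n x := by
      intro x y h
      have := x.isLt
      have := y.isLt
      simp only [Fin.lt_def, pr_val] at *; omega
    by_cases h : i < k ∧ a = pr n i ∧ c = pr n k
    · obtain ⟨h1, rfl, rfl⟩ := h
      rw [if_pos ⟨h1, rfl, rfl⟩, if_pos ⟨key _ _ h1, (pr_pr n k).symm, (pr_pr n i).symm⟩,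
        qc_symm, pr_pr]
    · rw [if_neg h, if_neg]
      rintro ⟨h1, rfl, rfl⟩
      refine h ⟨?_, (pr_pr n _).symm, (pr_pr n _).symm⟩
      exact key _ _ h1

lemma refl_monoid {M : Type*} [Monoid M] (R U T1 T2 J1 J2 B1 B2 : M)
    (h1 : R * T1 * T2 = T2 * T1 * R) (h2 : B1 * U * T2 = T2 * U * B1)
    (h2aux : B2 * U * T1 = T1 * U * B2) (h3 : R * B1 * B2 = B2 * B1 * R)
    (hJ : R * J1 * U * J2 = J2 * U * J1 * R)
    (c1 : J1 * T2 = T2 * J1) (c2 : J2 * B1 = B1 * J2)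
    (c3 : J1 * B2 = B2 * J1) (c4 : J2 * T1 = T1 * J2) :
    R * (T1 * J1 * B1) * U * (T2 * J2 * B2) = (T2 * J2 * B2) * U * (T1 * J1 * B1) * R := by
  calc R * (T1 * J1 * B1) * U * (T2 * J2 * B2)
      = R * T1 * J1 * (B1 * U * T2) * J2 * B2 := by simp only [mul_assoc]
    _ = R * T1 * (J1 * T2) * U * (B1 * J2) * B2 := by rw [h2]; simp only [mul_assoc]
    _ = (R * T1 * T2) * J1 * U * J2 * B1 * B2 := by rw [c1, ← c2]; simp only [mul_assoc]
    _ = T2 * T1 * (R * J1 * U * J2) * B1 * B2 := by rw [h1]; simp only [mul_assoc]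
    _ = T2 * T1 * J2 * U * J1 * (R * B1 * B2) := by rw [hJ]; simp only [mul_assoc]
    _ = T2 * (T1 * J2) * U * (J1 * B2) * B1 * R := by rw [h3]; simp only [mul_assoc]
    _ = T2 * J2 * (T1 * U * B2) * J1 * B1 * R := by rw [← c4, c3]; simp only [mul_assoc]
    _ = _ := by rw [← h2aux]; simp only [mul_assoc]

/-- Matrix acting in the first tensor factor. -/
def m1 (X : Matrix (Fin (2*n)) (Fin (2*n)) A) :
    Matrix (Fin (2*n) × Fin (2*n)) (Fin (2*n) × Fin (2*n)) A :=
  fun p s => if p.2 = s.2 then X p.1 s.1 else 0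

/-- Matrix acting in the second tensor factor. -/
def m2 (X : Matrix (Fin (2*n)) (Fin (2*n)) A) :
    Matrix (Fin (2*n) × Fin (2*n)) (Fin (2*n) × Fin (2*n)) A :=
  fun p s => if p.1 = s.1 then X p.2 s.2 else 0

lemma mul_m1 (Z : Matrix (Fin (2*n) × Fin (2*n)) (Fin (2*n) × Fin (2*n)) A)
    (X : Matrix (Fin (2*n)) (Fin (2*n)) A) (p) (j b : Fin (2*n)) :
    (Z * m1 X) p (j, b) = ∑ k, Z p (k, b) * X k j := by
  rw [Matrix.mul_apply, Fintype.sum_prod_type]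
  simp [m1]

lemma mul_m2 (Z : Matrix (Fin (2*n) × Fin (2*n)) (Fin (2*n) × Fin (2*n)) A)
    (X : Matrix (Fin (2*n)) (Fin (2*n)) A) (p) (j b : Fin (2*n)) :
    (Z * m2 X) p (j, b) = ∑ c, Z p (j, c) * X c b := by
  rw [Matrix.mul_apply, Fintype.sum_prod_type, Finset.sum_comm]
  simp [m2]

lemma m1_mul (Z : Matrix (Fin (2*n) × Fin (2*n)) (Fin (2*n) × Fin (2*n)) A)
    (X : Matrix (Fin (2*n)) (Fin (2*n)) A) (i a : Fin (2*n)) (s) :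
    (m1 X * Z) (i, a) s = ∑ k, X i k * Z (k, a) s := by
  rw [Matrix.mul_apply, Fintype.sum_prod_type]
  simp [m1]

lemma m2_mul (Z : Matrix (Fin (2*n) × Fin (2*n)) (Fin (2*n) × Fin (2*n)) A)
    (X : Matrix (Fin (2*n)) (Fin (2*n)) A) (i a : Fin (2*n)) (s) :
    (m2 X * Z) (i, a) s = ∑ c, X a c * Z (i, c) s := by
  rw [Matrix.mul_apply, Fintype.sum_prod_type, Finset.sum_comm]
  simp [m2]

lemma m1_m1 (X Y : Matrix (Fin (2*n)) (Fin (2*n)) A) : m1 (X * Y) = m1 X * m1 Y := by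
  ext ⟨i, a⟩ ⟨j, b⟩
  rw [mul_m1]
  by_cases h : a = b <;> simp [m1, h, Matrix.mul_apply]

lemma m2_m2 (X Y : Matrix (Fin (2*n)) (Fin (2*n)) A) : m2 (X * Y) = m2 X * m2 Y := by
  ext ⟨i, a⟩ ⟨j, b⟩
  rw [mul_m2]
  by_cases h : i = j <;> simp [m2, h, Matrix.mul_apply]

/-- R as a matrix over A. -/
def RR (n : ℕ) (A : Type*) [Ring A] [Algebra F A] :
    Matrix (Fin (2*n) × Fin (2*n)) (Fin (2*n) × Fin (2*n)) A :=
  fun p s => algebraMap F A (Rm n p s)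

/-- The partial transpose of R as a matrix over A. -/
def RU (n : ℕ) (A : Type*) [Ring A] [Algebra F A] :
    Matrix (Fin (2*n) × Fin (2*n)) (Fin (2*n) × Fin (2*n)) A :=
  fun p s => algebraMap F A (Rm n (s.1, p.2) (p.1, s.2))

/-- J as a matrix over A. -/
def JJ (n : ℕ) (A : Type*) [Ring A] [Algebra F A] : Matrix (Fin (2*n)) (Fin (2*n)) A :=
  Matrix.diagonal fun k => algebraMap F A (eps n k)

lemma alg_comm (r : F) (x : A) : x * algebraMap F A r = r • x := by
  rw [Algebra.smul_def, Algebra.commutes]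

lemma alg_comm' (r : F) (x : A) : algebraMap F A r * x = r • x := (Algebra.smul_def r x).symm

lemma JJ_comm1 (X : Matrix (Fin (2*n)) (Fin (2*n)) A) :
    m1 (JJ n A) * m2 X = m2 X * m1 (JJ n A) := by
  ext ⟨i, a⟩ ⟨j, b⟩
  rw [mul_m2, mul_m1]
  by_cases h : i = j
  · subst h; simp [m1, m2, JJ, Matrix.diagonal_apply, alg_comm, alg_comm']
  · simp [m1, m2, JJ, Matrix.diagonal_apply, h]

lemma JJ_comm2 (X : Matrix (Fin (2*n)) (Fin (2*n)) A) :
    m2 (JJ n A) * m1 X = m1 X * m2 (JJ n A) := by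
  ext ⟨i, a⟩ ⟨j, b⟩
  rw [mul_m2, mul_m1]
  by_cases h : a = b
  · subst h; simp [m1, m2, JJ, Matrix.diagonal_apply, alg_comm, alg_comm']
  · simp [m1, m2, JJ, Matrix.diagonal_apply, h]

lemma JJ_refl : RR n A * m1 (JJ n A) * RU n A * m2 (JJ n A)
    = m2 (JJ n A) * RU n A * m1 (JJ n A) * RR n A := by
  ext ⟨i, a⟩ ⟨j, b⟩
  have h := congrArg (algebraMap F A) (J_refl i a j b)
  rw [← R_row, ← R_col] at h
  rw [mul_m2]
  have l1 : ∀ c, (RR n A * m1 (JJ n A) * RU n A) (i, a) (j, c) =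
      ∑ k, ∑ d, algebraMap F A (Rm n (i, a) (k, d) * eps n k * Rm n (j, d) (k, c)) := by
    intro c
    rw [Matrix.mul_apply, Fintype.sum_prod_type]
    simp only [mul_m1, RR, RU, JJ, Matrix.diagonal_apply, mul_ite, mul_zero,
      Finset.sum_ite_eq', Finset.mem_univ, if_true, map_mul]
  have l2 : ∀ p : Fin (2*n) × Fin (2*n), (m2 (JJ n A) * RU n A * m1 (JJ n A)) (i, a) p =
      algebraMap F A (eps n a * Rm n (p.1, a) (i, p.2) * eps n p.1) := by
    rintro ⟨l, d⟩
    rw [mul_m1]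
    simp only [m2_mul, RU, JJ, Matrix.diagonal_apply, mul_ite, mul_zero, ite_mul, zero_mul,
      Finset.sum_ite_eq', Finset.sum_ite_eq, Finset.mem_univ, if_true, map_mul]
  rw [Matrix.mul_apply, Fintype.sum_prod_type, Finset.sum_comm]
  simp only [l1, l2]
  simp only [RR, JJ, Matrix.diagonal_apply, mul_ite, mul_zero, Finset.sum_ite_eq',
    Finset.mem_univ, if_true]
  simp only [map_sum, smul_eq_mul] at h
  convert h using 1
  · rw [Finset.sum_mul]
    refine Finset.sum_congr rfl fun k _ => ?_
    rw [Finset.sum_mul]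
    refine Finset.sum_congr rfl fun c _ => ?_
    rw [← map_mul]; congr 1; ring
  · refine Finset.sum_congr rfl fun k _ => Finset.sum_congr rfl fun c _ => ?_
    rw [← map_mul]; congr 1; ring

variable {t tb : Fin (2*n) → Fin (2*n) → A}

lemma RR_mul (Z : Matrix (Fin (2*n) × Fin (2*n)) (Fin (2*n) × Fin (2*n)) A)
    (i a : Fin (2*n)) (s) :
    (RR n A * Z) (i, a) s = ∑ k, ∑ c, Rm n (i, a) (k, c) • Z (k, c) s := by
  rw [Matrix.mul_apply, Fintype.sum_prod_type]
  simp only [RR, alg_comm']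

lemma mul_RR (Z : Matrix (Fin (2*n) × Fin (2*n)) (Fin (2*n) × Fin (2*n)) A)
    (j b : Fin (2*n)) (p) :
    (Z * RR n A) p (j, b) = ∑ c, ∑ l, Rm n (l, c) (j, b) • Z p (l, c) := by
  rw [Matrix.mul_apply, Fintype.sum_prod_type, Finset.sum_comm]
  simp only [RR, alg_comm]

lemma m1_m2 (X Y : Matrix (Fin (2*n)) (Fin (2*n)) A) (i a j b : Fin (2*n)) :
    (m1 X * m2 Y) (i, a) (j, b) = X i j * Y a b := by
  rw [mul_m2]; simp [m1]

lemma m2_m1 (X Y : Matrix (Fin (2*n)) (Fin (2*n)) A) (i a j b : Fin (2*n)) :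
    (m2 X * m1 Y) (i, a) (j, b) = X a b * Y i j := by
  rw [mul_m1]; simp [m2]

lemma m1_RU_m2 (X Y : Matrix (Fin (2*n)) (Fin (2*n)) A) (i a j b : Fin (2*n)) :
    (m1 X * RU n A * m2 Y) (i, a) (j, b) = ∑ k, ∑ c, Rm n (j, a) (k, c) • (X i k * Y c b) := by
  rw [mul_m2, Finset.sum_comm]
  refine Finset.sum_congr rfl fun c _ => ?_
  rw [m1_mul, Finset.sum_mul]
  refine Finset.sum_congr rfl fun k _ => ?_
  simp only [RU, alg_comm, smul_mul_assoc]

lemma m2_RU_m1 (X Y : Matrix (Fin (2*n)) (Fin (2*n)) A) (i a j b : Fin (2*n)) :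
    (m2 X * RU n A * m1 Y) (i, a) (j, b) = ∑ c, ∑ l, Rm n (l, c) (i, b) • (X a c * Y l j) := by
  rw [mul_m1, Finset.sum_comm]
  refine Finset.sum_congr rfl fun c _ => ?_
  rw [m2_mul, Finset.sum_mul]
  refine Finset.sum_congr rfl fun k _ => ?_
  simp only [RU, alg_comm, smul_mul_assoc]

/-- The reflection equation. -/
lemma refl_eq (D : Dat t tb) (i a j b : Fin (2*n)) :
    rowR (fun k c => rowR (fun l d => sa t tb k l * sa t tb d b) j c) i a =
    colR (fun l d => colR (fun k c => sa t tb a c * sa t tb k l) i d) j b := by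
  obtain ⟨T, hT⟩ : ∃ T : Matrix (Fin (2*n)) (Fin (2*n)) A, ∀ i j, T i j = t i j := ⟨t, fun _ _ => rfl⟩
  obtain ⟨B, hB⟩ : ∃ T : Matrix (Fin (2*n)) (Fin (2*n)) A, ∀ i j, T i j = tb j i :=
    ⟨fun i j => tb j i, fun _ _ => rfl⟩
  have hS : ∀ i j, (T * JJ n A * B) i j = sa t tb i j := by
    intro i j
    rw [Matrix.mul_apply]
    simp only [JJ, Matrix.mul_diagonal, sa, hT, hB, alg_comm, smul_mul_assoc]
  have h := refl_monoid (RR n A) (RU n A) (m1 T) (m2 T) (m1 (JJ n A)) (m2 (JJ n A)) (m1 B) (m2 B)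
    ?_ ?_ ?_ ?_ JJ_refl (JJ_comm1 _) (JJ_comm2 _) (JJ_comm1 _) (JJ_comm2 _)
  · rw [← m1_m1, ← m1_m1, ← m2_m2, ← m2_m2] at h
    have h := congrFun (congrFun h (i, a)) (j, b)
    simp only [← R_row, ← R_col]
    rw [mul_RR, mul_assoc, mul_assoc, RR_mul] at h
    simp only [← mul_assoc (m1 _), m1_RU_m2, m2_RU_m1, hS] at h
    exact h
  · ext ⟨i, a⟩ ⟨j, b⟩
    rw [mul_RR, mul_assoc, RR_mul]
    simp only [m1_m2, m2_m1, hT]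
    exact D.rtt_tt i a j b
  · ext ⟨i, a⟩ ⟨j, b⟩
    rw [m1_RU_m2, m2_RU_m1]
    simp only [hT, hB]
    exact D.rtt_bt j a i b
  · ext ⟨i, a⟩ ⟨j, b⟩
    rw [m1_RU_m2, m2_RU_m1]
    simp only [hT, hB]
    rw [Finset.sum_comm (γ := Fin (2*n))]
    have := D.rtt_bt b i a j
    simp only [Rm_symm b i, Rm_symm _ _ a j] at this
    rw [Finset.sum_comm, this, Finset.sum_comm]
  · ext ⟨i, a⟩ ⟨j, b⟩
    rw [mul_RR, mul_assoc, RR_mul]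
    simp only [m1_m2, m2_m1, hB]
    have := D.rtt_bb b j a i
    simp only [Rm_symm b j, Rm_symm _ _ a i] at this
    rw [this, Finset.sum_comm]

lemma s_upper (D : Dat t tb) {i j : Fin (2*n)} (h : i < j) : sa t tb i j = 0 := by
  refine Finset.sum_eq_zero fun k _ => ?_
  rcases lt_or_ge i k with h' | h'
  · rw [D.t_upper _ _ h', zero_mul, smul_zero]
  · rw [D.tb_lower _ _ (lt_of_le_of_lt h' h), mul_zero, smul_zero]

lemma s_diag (D : Dat t tb) (i : Fin (2*n)) : sa t tb i i = eps n i • 1 := by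
  unfold sa
  rw [Finset.sum_eq_single i]
  · rw [D.diag]
  · intro k _ hk
    rcases lt_or_gt_of_ne hk with h' | h'
    · rw [D.tb_lower _ _ h', mul_zero, smul_zero]
    · rw [D.t_upper _ _ h', zero_mul, smul_zero]
  · simp

lemma m_upper (D : Dat t tb) {i a : Fin (2*n)} (h : a < i) : ma t tb i a = 0 := by
  refine Finset.sum_eq_zero fun k _ => ?_
  rcases lt_or_ge a k with h' | h'
  · rw [D.t_upper _ _ h', mul_zero, smul_zero]
  · rw [D.tb_lower _ _ (lt_of_le_of_lt h' h), zero_mul, smul_zero]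

lemma m_rel (D : Dat t tb) (i a : Fin (2*n)) : rowR (ma t tb) i a = q • sa t tb a i := by
  have h : ∀ m, rowR (fun k c => tb k m * t c m) i a = q • (t a m * tb i m) := by
    intro m
    have := D.rtt_bt i a m m
    rw [R_row (fun k c => tb k m * t c m), R_col (fun l c => t a c * tb i l)] at this
    rw [this]
    simp [colR, qd_self, ne_pr]
  rw [← R_row]
  have e : q • sa t tb a i = ∑ m, eps n m • rowR (fun k c => tb k m * t c m) i a := by
    simp only [h, sa, Finset.smul_sum]
    refine Finset.sum_congr rfl fun m _ => ?_
    rw [smul_comm]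
  rw [e]
  simp only [← R_row, ma, Finset.smul_sum]
  rw [Finset.sum_comm' (t' := Finset.univ) (s' := fun _ => Finset.univ) (by simp)]
  rw [Finset.sum_comm]
  refine Eq.trans ?_ (Finset.sum_comm)
  refine Finset.sum_congr rfl fun k _ => ?_
  rw [Finset.sum_comm]
  refine Finset.sum_congr rfl fun m _ => Finset.sum_congr rfl fun c _ => ?_
  rw [smul_comm]

lemma m_gen (D : Dat t tb) {i a : Fin (2*n)} (h : i < a) (h' : a ≠ pr n i) :
    ma t tb i a = q • sa t tb a i := by
  rw [← m_rel D, rowR, qd_gen h.ne' h', if_neg h', m_upper D h]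
  simp

lemma m_self (D : Dat t tb) (i : Fin (2*n)) : ma t tb i i = eps n i • 1 := by
  have h := m_rel D i i
  rw [rowR, qd_self, if_neg (ne_pr n i), if_neg (lt_irrefl _), add_zero, sub_zero, s_diag D] at h
  exact smul_right_injective A q_ne h

lemma m_anti (D : Dat t tb) {i : Fin (2*n)} (h : i < pr n i) :
    ma t tb i (pr n i) = (q * q) • sa t tb (pr n i) i
      + ∑ k, (if i < k then (q * qc n i k) • ma t tb k (pr n k) else 0) := by
  have e := m_rel D i (pr n i)
  rw [rowR, qd_pr, if_pos rfl, m_upper D h, smul_zero, ite_self, add_zero, sub_eq_iff_eq_add] at e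
  have e' := congrArg (fun x => q • x) e
  simp only [smul_smul, smul_add, mul_inv_cancel₀ q_ne, one_smul, Finset.smul_sum, smul_ite,
    smul_zero] at e'
  exact e'

lemma XS (D : Dat t tb) {j a : Fin (2*n)} (h : pr n j ≠ a) :
    ∑ k, ((dd n k)⁻¹ * eps n k) • (ma t tb j (pr n k) * sa t tb k a) = 0 := by
  have h1 : ∀ m l, ∑ k, ((dd n k)⁻¹ * eps n k) • (t (pr n k) m * t k l)
      = if pr n m = l then (- dd n m * eps n m) • (1 : A) else 0 := by
    intro m l
    have e := congrArg (fun x => (- dd n m * eps n m) • x) (D.cent_t2 (pr n m) l)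
    simp only [smul_ite, smul_zero, Finset.smul_sum, pr_pr] at e
    rw [← e]
    refine Finset.sum_congr rfl fun k _ => ?_
    rw [smul_smul]
    congr 1
    rw [dd_pr, eps_pr]
    have := dd_ne n m
    have := dd_ne n k
    have h := eps_sq n m
    field_simp
    linear_combination (-eps n k) * h
  have h2 := D.cent_tb1 j (pr n a)
  rw [if_neg (fun e => h (by rw [e, pr_pr]))] at h2
  simp only [pr_pr] at h2
  have h3 := congrArg (fun x => (- dd n (pr n a) * eps n a) • x) h2
  simp only [smul_zero, Finset.smul_sum] at h3
  rw [← h3]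
  have hk : ∀ k, ((dd n k)⁻¹ * eps n k) • (ma t tb j (pr n k) * sa t tb k a) =
      ∑ m, ∑ l, (eps n m * eps n l) • (tb j m *
        (((dd n k)⁻¹ * eps n k) • (t (pr n k) m * t k l)) * tb a l) := by
    intro k
    simp only [ma, sa, Finset.sum_mul, Finset.mul_sum, Finset.smul_sum]
    rw [Finset.sum_comm]
    refine Finset.sum_congr rfl fun m _ => Finset.sum_congr rfl fun l _ => ?_
    simp only [mul_smul_comm, smul_mul_assoc, smul_smul, mul_assoc]
    congr 1
    ring
  simp only [hk]
  calc _ = ∑ m, ∑ l, (eps n m * eps n l) • (tb j m *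
        (∑ k, ((dd n k)⁻¹ * eps n k) • (t (pr n k) m * t k l)) * tb a l) := by
        rw [Finset.sum_comm]
        refine Finset.sum_congr rfl fun m _ => ?_
        rw [Finset.sum_comm]
        refine Finset.sum_congr rfl fun l _ => ?_
        rw [Finset.mul_sum, Finset.sum_mul, Finset.smul_sum]
    _ = _ := by
        simp only [h1]
        refine Finset.sum_congr rfl fun m _ => ?_
        rw [Finset.sum_eq_single (pr n m)]
        · simp only [if_true, mul_smul_comm, smul_mul_assoc, mul_one, smul_smul]
          congr 1
          rw [eps_pr, dd_pr]
          have := dd_ne n a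
          field_simp
          linear_combination (dd n m * eps n m) * (eps_sq n m - eps_sq n a)
        · intro l _ hl
          rw [if_neg (Ne.symm hl)]; simp
        · simp

lemma s_comm (D : Dat t tb) {a j l : Fin (2*n)} (h1 : a < j) (h2 : j < l) (h3 : (l : ℕ) < n) :
    sa t tb (pr n l) l * sa t tb j a = sa t tb j a * sa t tb (pr n l) l := by
  have e := refl_eq D (pr n l) j l a
  have hv := pr_val n l
  have hv' := pr_val n (pr n l)
  have g1 : j < pr n l := by simp only [Fin.lt_def] at *; omega
  have g2 : a < pr n l := h1.trans g1
  have g3 : a < l := h1.trans h2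
  have x1 : qd n (pr n l) j = 1 := qd_gen g1.ne (by rw [pr_pr]; exact h2.ne)
  have x2 : qd n l j = 1 := qd_gen h2.ne g1.ne
  have x3 : qd n l a = 1 := qd_gen g3.ne g2.ne
  have x4 : qd n (pr n l) a = 1 := qd_gen g2.ne (by rw [pr_pr]; exact g3.ne)
  have z1 : sa t tb j (pr n l) = 0 := s_upper D g1
  have z2 : sa t tb j l = 0 := s_upper D h2
  have z3 : ∀ k x, (if k < pr n l then qc n k (pr n l) • (sa t tb j (pr n k) * x) else 0) = 0 := by
    intro k x
    split_ifs with h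
    · rw [s_upper D, zero_mul, smul_zero]
      have := pr_val n k
      simp only [Fin.lt_def] at *; omega
    · rfl
  simp only [rowR, colR, pr_pr, x1, x2, x3, x4, z1, z2, z3, if_neg g1.not_gt, if_neg h2.ne,
    if_neg h2.not_gt, if_neg g1.ne, if_neg g2.ne, if_neg g3.ne, if_pos g2, if_pos g3] at e
  simpa using e

/-- The auxiliary elements. -/
def yy (t tb : Fin (2*n) → Fin (2*n) → A) (j a l : Fin (2*n)) : A :=
  qd n j l • (sa t tb (pr n l) j * sa t tb l a)
    + (if j < l then hq • (sa t tb (pr n l) l * sa t tb j a) else 0)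

lemma swap_rel (D : Dat t tb) {a j k : Fin (2*n)} (h1 : a < j) (h2 : a ≠ pr n j)
    (h3 : (k : ℕ) < n) :
    q⁻¹ • yy t tb j a k - ∑ l, (if l < k then (hq * dd n k * (dd n l)⁻¹) • yy t tb j a l else 0)
    = qd n (pr n k) a • (sa t tb k a * sa t tb (pr n k) j)
      + hq • (qd n (pr n k) j • (sa t tb k j * sa t tb (pr n k) a)) := by
  have e := refl_eq D (pr n k) k j a
  have hv := pr_val n k
  have g1 : k < pr n k := by simp only [Fin.lt_def] at *; omega
  have hin : ∀ l d, colR (fun k' c => sa t tb k c * sa t tb k' l) (pr n k) d =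
      qd n (pr n k) d • (sa t tb k d * sa t tb (pr n k) l) := by
    intro l d
    have z3 : ∀ m x, (if m < pr n k then qc n m (pr n k) • (sa t tb k (pr n m) * x) else 0) = 0 := by
      intro m x
      split_ifs with h
      · rw [s_upper D, zero_mul, smul_zero]
        have := pr_val n m
        simp only [Fin.lt_def] at *; omega
      · rfl
    simp only [colR, z3, s_upper D g1]
    simp
  have hY : ∀ l : Fin (2*n), (l : ℕ) < n →
      rowR (fun l' d => sa t tb (pr n l) l' * sa t tb d a) j l = yy t tb j a l := by
    intro l hl
    unfold rowR yy
    rw [sub_eq_self]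
    split_ifs with h
    · refine Finset.sum_eq_zero fun m _ => ?_
      split_ifs with h'
      · beta_reduce
        rw [s_upper D, zero_mul, smul_zero]
        rwa [h, pr_pr]
      · rfl
    · rfl
  simp only [hin] at e
  rw [colR, qd_gen h1.ne h2, if_pos h1, if_neg h2, one_smul, sub_zero] at e
  rw [← e, rowR, if_pos (pr_pr n k).symm, if_neg g1.not_gt, add_zero, hY k h3]
  have := qd_pr (pr n k)
  rw [pr_pr] at this
  rw [this]
  congr 1
  have hinv : Function.Involutive (pr n) := pr_pr n
  refine Fintype.sum_equiv (Function.Involutive.toPerm (pr n) hinv) _ _ fun l => ?_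
  have hl := pr_val n l
  have i1 := l.isLt
  have i2 := k.isLt
  simp only [Function.Involutive.coe_toPerm, pr_pr]
  by_cases h : l < k
  · have hlk : pr n k < pr n l := by simp only [Fin.lt_def] at *; omega
    have hln : (l : ℕ) < n := by simp only [Fin.lt_def] at *; omega
    rw [if_pos h, if_pos hlk, hY l hln]
    congr 1
    rw [qc, eps_pr, eps_pr, bar_pr, bar_pr, eps, eps, if_pos h3, if_pos hln, hq, dd, dd,
      sub_neg_eq_add, neg_add_eq_sub, zpow_sub₀ q_ne]
    ring
  · have hlk : ¬ pr n k < pr n l := by simp only [Fin.lt_def] at *; omega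
    rw [if_neg h, if_neg hlk]

/-- Ordered products with rows in the half-open interval (lo, hi]. -/
def GS (s : Fin (2*n) → Fin (2*n) → A) (lo hi : Fin (2*n)) : Set A :=
  {x : A | ∃ p : ℕ, 0 < p ∧ ∃ is as : Fin p → Fin (2*n),
        StrictMono is ∧
        (∀ m, lo < is m ∧ is m ≤ hi) ∧
        (∀ m, is m ≤ pr n (as m) ∧ as m < is m) ∧
        x = (List.ofFn fun m => s (is m) (as m)).prod}

lemma GS_single (s : Fin (2*n) → Fin (2*n) → A) {lo hi k a : Fin (2*n)} (h1 : lo < k) (h2 : k ≤ hi)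
    (h3 : a < k) (h4 : k ≤ pr n a) : s k a ∈ Submodule.span F (GS s lo hi) := by
  refine Submodule.subset_span ⟨1, one_pos, fun _ => k, fun _ => a, ?_, fun _ => ⟨h1, h2⟩,
    fun _ => ⟨h4, h3⟩, by simp⟩
  intro x y h
  exact absurd h (by rw [Subsingleton.elim x y]; exact lt_irrefl _)

lemma GS_cons (s : Fin (2*n) → Fin (2*n) → A) {lo hi k a : Fin (2*n)} (h1 : lo < k) (h2 : k ≤ hi)
    (h3 : a < k) (h4 : k ≤ pr n a) {x : A} (hx : x ∈ Submodule.span F (GS s k hi)) :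
    s k a * x ∈ Submodule.span F (GS s lo hi) := by
  induction hx using Submodule.span_induction with
  | mem x hx =>
    obtain ⟨p, hp, is, as, hm, hr, hc, rfl⟩ := hx
    refine Submodule.subset_span ⟨p + 1, Nat.succ_pos _, Fin.cons k is, Fin.cons a as, ?_, ?_, ?_, ?_⟩
    · intro x y hxy
      induction x using Fin.cases with
      | zero =>
        induction y using Fin.cases with
        | zero => exact absurd hxy (lt_irrefl _)
        | succ y => simpa using (hr y).1
      | succ x =>
        induction y using Fin.cases with
        | zero => exact absurd hxy (Fin.not_lt_zero _)
        | succ y => simpa using hm (Fin.succ_lt_succ_iff.mp hxy)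
    · intro m
      refine Fin.cases ?_ (fun m => ?_) m
      · simpa using ⟨h1, h2⟩
      · simpa using ⟨h1.trans (hr m).1, (hr m).2⟩
    · intro m
      refine Fin.cases ?_ (fun m => ?_) m
      · simpa using ⟨h4, h3⟩
      · simpa using hc m
    · simp [List.ofFn_succ]
  | zero => simp
  | add x y _ _ hx hy => rw [mul_add]; exact add_mem hx hy
  | smul c x _ hx => rw [mul_smul_comm]; exact Submodule.smul_mem _ _ hx

/-- Main claim in the generic setting. -/
lemma key (D : Dat t tb) : ∀ (N : ℕ) (i j : Fin (2*n)), (i : ℕ) = N → j < i → pr n i < j →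
    sa t tb i j ∈ Submodule.span F (GS (sa t tb) (pr n i) (pr n j)) := by
  intro N
  induction N using Nat.strong_induction_on with
  | _ N IH =>
  intro i j hN hji hij
  obtain ⟨a, rfl⟩ : ∃ a, i = pr n a := ⟨pr n i, (pr_pr n i).symm⟩
  rw [pr_pr] at hij ⊢
  set s := sa t tb with hs
  set G := Submodule.span F (GS s a (pr n j)) with hG
  have va := pr_val n a
  have vj := pr_val n j
  have ia := a.isLt
  have ij := j.isLt
  have haj : a ≠ pr n j := by
    intro h; rw [h, pr_pr] at hji; exact lt_irrefl _ hji
  have han : (a : ℕ) < n := by simp only [Fin.lt_def] at *; omega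
  -- commuting products
  have hcomm : ∀ l : Fin (2*n), j < l → (l : ℕ) < n → s (pr n l) l * s j a ∈ G := by
    intro l h1 h2
    have vl := pr_val n l
    rw [hs, s_comm D hij h1 h2]
    refine GS_cons s hij ?_ hij ?_ (GS_single s ?_ ?_ ?_ ?_) <;>
      simp only [Fin.lt_def, Fin.le_def] at * <;> omega
  -- the elements on the right-hand side of the swap relation
  have hw : ∀ k : Fin (2*n), a < k → (k : ℕ) < n →
      q⁻¹ • yy t tb j a k - ∑ l, (if l < k then (hq * dd n k * (dd n l)⁻¹) • yy t tb j a l else 0) ∈ G := by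
    intro k h1 h2
    have vk := pr_val n k
    rw [swap_rel D hij haj h2]
    refine add_mem (Submodule.smul_mem _ _ ?_) (Submodule.smul_mem _ _ (Submodule.smul_mem _ _ ?_))
    · rcases lt_trichotomy j (pr n k) with h | h | h
      · refine GS_cons s h1 ?_ h1 ?_ ?_
        · simp only [Fin.lt_def, Fin.le_def] at *; omega
        · simp only [Fin.lt_def, Fin.le_def] at *; omega
        · rcases lt_or_ge k j with h' | h'
          · have := IH (pr n k) (by simp only [Fin.lt_def, Fin.le_def] at *; omega) (pr n k) j rfl h
              (by rwa [pr_pr])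
            rwa [pr_pr] at this
          · apply GS_single s <;> simp only [Fin.lt_def, Fin.le_def] at * <;> omega
      · rw [← h, s_diag D, mul_smul_comm, mul_one]
        refine Submodule.smul_mem _ _ (GS_single s h1 ?_ h1 ?_)
        · rw [h, pr_pr]
        · simp only [Fin.lt_def, Fin.le_def] at *; omega
      · rw [s_upper D h, mul_zero]; exact zero_mem _
    · rcases lt_trichotomy j k with h | h | h
      · refine GS_cons s h1 ?_ h ?_ (GS_single s ?_ ?_ ?_ ?_) <;>
          simp only [Fin.lt_def, Fin.le_def] at * <;> omega
      · rw [← h, s_diag D, smul_mul_assoc, one_mul]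
        refine Submodule.smul_mem _ _ (GS_single s ?_ ?_ ?_ ?_) <;>
          simp only [Fin.lt_def, Fin.le_def] at * <;> omega
      · rw [s_upper D h, zero_mul]; exact zero_mem _
  -- antidiagonal entries of the opposite product
  have hanti : ∀ (M : ℕ) (m : Fin (2*n)), 2*n - (m : ℕ) = M → j < m →
      ma t tb m (pr n m) * s j a ∈ G := by
    intro M
    induction M using Nat.strong_induction_on with
    | _ M IH2 =>
    intro m hm hjm
    have vm := pr_val n m
    have im := m.isLt
    rcases lt_or_ge (m : ℕ) n with h | h
    · rw [m_anti D (by simp only [Fin.lt_def] at *; omega), add_mul, Finset.sum_mul, smul_mul_assoc]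
      refine add_mem (Submodule.smul_mem _ _ (hcomm m hjm h)) (Submodule.sum_mem _ fun k _ => ?_)
      split_ifs with h'
      · rw [smul_mul_assoc]
        refine Submodule.smul_mem _ _ (IH2 (2*n - (k:ℕ)) ?_ k rfl (hjm.trans h'))
        simp only [Fin.lt_def] at *; omega
      · rw [zero_mul]; exact zero_mem _
    · rw [m_upper D (by simp only [Fin.lt_def] at *; omega), zero_mul]; exact zero_mem _
  -- partial sums
  let P : ℕ → A := fun m => ∑ l : Fin (2*n), if (l : ℕ) < m then (dd n l)⁻¹ • yy t tb j a l else 0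
  have hterm : ∀ k : Fin (2*n), ((dd n k)⁻¹ * eps n k) • (ma t tb j (pr n k) * s k a)
      - q • (if (k : ℕ) < n then (dd n k)⁻¹ • yy t tb j a k else 0) ∈ G := by
    intro k
    have vk := pr_val n k
    have ik := k.isLt
    rcases lt_or_ge (k : ℕ) n with h | h
    · rw [if_pos h, eps, if_pos h, mul_one, smul_comm q, ← smul_sub]
      refine Submodule.smul_mem _ _ ?_
      unfold yy
      rw [← hs, smul_add, ← sub_sub]
      refine sub_mem ?_ (Submodule.smul_mem _ _ ?_)
      · rcases lt_trichotomy j (pr n k) with h' | h' | h'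
        · by_cases hkj : k = j
          · subst hkj
            rw [m_anti D h', add_mul, qd_self, smul_smul, smul_mul_assoc, add_sub_cancel_left,
              Finset.sum_mul]
            refine Submodule.sum_mem _ fun m _ => ?_
            split_ifs with hm
            · rw [smul_mul_assoc]
              exact Submodule.smul_mem _ _ (hanti _ m rfl hm)
            · rw [zero_mul]; exact zero_mem _
          · rw [m_gen D h' (fun e => hkj (by rw [← pr_pr n k, e, pr_pr])),
              qd_gen hkj (fun e => h'.ne (by rw [e, pr_pr])), one_smul, smul_mul_assoc, sub_self]
            exact zero_mem _
        · have hk : s k a ∈ G := by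
            have hkj : k = pr n j := by rw [h', pr_pr]
            apply GS_single s <;> simp only [Fin.lt_def, Fin.le_def, hkj] at * <;> omega
          rw [← h', m_self D, hs, s_diag D, smul_mul_assoc, one_mul]
          exact sub_mem (Submodule.smul_mem _ _ hk)
            (Submodule.smul_mem _ _ (Submodule.smul_mem _ _ (Submodule.smul_mem _ _ hk)))
        · rw [m_upper D h', hs, s_upper D h']; simp
      · split_ifs with h'
        · exact Submodule.smul_mem _ _ (hcomm k h' h)
        · exact zero_mem _
    · rw [if_neg (not_lt.mpr h), smul_zero, sub_zero]
      refine Submodule.smul_mem _ _ ?_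
      rcases lt_trichotomy j (pr n k) with h' | h' | h'
      · rw [m_gen D h' (fun e => ?_), smul_mul_assoc]
        · refine Submodule.smul_mem _ _ (GS_cons s ?_ ?_ ?_ ?_ (GS_single s ?_ ?_ ?_ ?_)) <;>
            simp only [Fin.lt_def, Fin.le_def] at * <;> omega
        · have := congrArg Fin.val e
          simp only [Fin.lt_def] at *; omega
      · rw [← h', m_self D, smul_mul_assoc, one_mul]
        have := congrArg Fin.val h'
        refine Submodule.smul_mem _ _ (GS_single s ?_ ?_ ?_ ?_) <;>
            simp only [Fin.lt_def, Fin.le_def] at * <;> omega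
      · rw [m_upper D h', zero_mul]; exact zero_mem _
  have hPn : P n ∈ G := by
    have e := Submodule.sum_mem G (t := Finset.univ) fun k _ => hterm k
    rw [Finset.sum_sub_distrib, XS D haj.symm, zero_sub, ← Finset.smul_sum] at e
    have e' := Submodule.smul_mem G (-q⁻¹) e
    rwa [smul_neg, neg_smul, neg_neg, smul_smul, inv_mul_cancel₀ q_ne, one_smul] at e'
  have hsucc : ∀ k : Fin (2*n), P ((k : ℕ) + 1) = P k + (dd n k)⁻¹ • yy t tb j a k := by
    intro k
    have : (dd n k)⁻¹ • yy t tb j a k =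
        ∑ l : Fin (2*n), if l = k then (dd n l)⁻¹ • yy t tb j a l else 0 := by simp
    simp only [P]
    rw [this, ← Finset.sum_add_distrib]
    refine Finset.sum_congr rfl fun l _ => ?_
    rcases lt_trichotomy (l : ℕ) (k : ℕ) with h | h | h
    · rw [if_pos (by omega), if_pos h, if_neg (by intro e; rw [e] at h; omega), add_zero]
    · rw [if_pos (by omega), if_neg (by omega), if_pos (Fin.ext h), zero_add]
    · rw [if_neg (by omega), if_neg (by omega), if_neg (by intro e; rw [e] at h; omega), add_zero]
  have hstep : ∀ k : Fin (2*n), a < k → (k : ℕ) < n → P ((k : ℕ) + 1) ∈ G → P k ∈ G := by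
    intro k h1 h2 h3
    have w := hw k h1 h2
    have e : (∑ l, (if l < k then (hq * dd n k * (dd n l)⁻¹) • yy t tb j a l else 0))
        = (hq * dd n k) • P k := by
      simp only [P, Finset.smul_sum, smul_ite, smul_zero, smul_smul, Fin.lt_def]
    rw [e] at w
    rw [hsucc] at h3
    have e2 : P k = (q⁻¹ * q⁻¹) • ((P k + (dd n k)⁻¹ • yy t tb j a k)
        - (q * (dd n k)⁻¹) • (q⁻¹ • yy t tb j a k - (hq * dd n k) • P k)) := by
      have q0 := q_ne
      have d0 := dd_ne n k
      have c1 : q * (dd n k)⁻¹ * q⁻¹ = (dd n k)⁻¹ := by field_simp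
      have c2 : q * (dd n k)⁻¹ * (hq * dd n k) = q * q - 1 := by unfold hq; field_simp
      rw [smul_sub (q * (dd n k)⁻¹), smul_smul, smul_smul, c1, c2, sub_smul, one_smul]
      have : P k + (dd n k)⁻¹ • yy t tb j a k - ((dd n k)⁻¹ • yy t tb j a k - ((q * q) • P k - P k))
          = (q * q) • P k := by abel
      rw [this, smul_smul]
      have c3 : q⁻¹ * q⁻¹ * (q * q) = 1 := by field_simp
      rw [c3, one_smul]
    rw [e2]
    exact Submodule.smul_mem _ _ (sub_mem h3 (Submodule.smul_mem _ _ w))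
  have hall : ∀ d m : ℕ, m + d = n → (a : ℕ) < m → P m ∈ G := by
    intro d
    induction d with
    | zero => intro m h _; rw [show m = n by omega]; exact hPn
    | succ d ihd =>
      intro m h h'
      have hm : m < 2*n := by omega
      exact hstep ⟨m, hm⟩ h' (by simp only; omega) (ihd (m+1) (by omega) (by omega))
  have hPa := hall (n - ((a : ℕ) + 1)) ((a : ℕ) + 1) (by omega) (by omega)
  rw [hsucc] at hPa
  have hP0 : P a = 0 := by
    refine Finset.sum_eq_zero fun l _ => ?_
    split_ifs with h
    · have hl : l < a := h
      rw [yy, s_upper D hl, if_neg (hl.trans hij).not_gt]; simp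
    · rfl
  have hy : yy t tb j a a = s (pr n a) j := by
    rw [yy, if_neg hij.not_gt, qd_gen hij.ne haj, s_diag D, eps, if_pos han]
    simp [hs]
  rw [hP0, zero_add, hy] at hPa
  have e' := Submodule.smul_mem G (dd n a) hPa
  rwa [smul_smul, mul_inv_cancel₀ (dd_ne n a), one_smul] at e'

end generic

lemma dat (n : ℕ) : Dat (tU n) (tbU n) := by
  have h : ∀ {x y : FA n}, rel n x y →
      RingQuot.mkAlgHom F (rel n) x = RingQuot.mkAlgHom F (rel n) y :=
    fun hxy => RingQuot.mkAlgHom_rel F hxy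
  constructor
  · intro i j hij
    simpa [tU] using h (rel.t_upper i j hij)
  · intro i j hij
    simpa [tbU] using h (rel.tb_lower i j hij)
  · intro i
    simpa [tU, tbU] using h (rel.t_tb_diag i)
  · intro i a j b
    simpa only [tU, tbU, map_sum, map_smul, map_mul] using h (rel.rtt_tt i a j b)
  · intro i a j b
    simpa only [tU, tbU, map_sum, map_smul, map_mul] using h (rel.rtt_bb i a j b)
  · intro i a j b
    simpa only [tU, tbU, map_sum, map_smul, map_mul] using h (rel.rtt_bt i a j b)
  · intro i j
    have := h (rel.cent_tb1 i j)
    rw [apply_ite (RingQuot.mkAlgHom F (rel n)), map_one, map_zero] at this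
    simpa only [tU, tbU, map_sum, map_smul, map_mul] using this
  · intro i j
    have := h (rel.cent_t2 i j)
    rw [apply_ite (RingQuot.mkAlgHom F (rel n)), map_one, map_zero] at this
    simpa only [tU, tbU, map_sum, map_smul, map_mul] using this

lemma sU_eq (n : ℕ) : sU n = sa (tU n) (tbU n) := by
  funext i j
  unfold sU sa
  refine Finset.sum_subset (Finset.subset_univ _) fun k _ hk => ?_
  rw [Finset.mem_Icc, not_and_or, not_le, not_le] at hk
  rcases hk with hk | hk
  · rw [(dat n).tb_lower _ _ hk, mul_zero, smul_zero]
  · rw [(dat n).t_upper _ _ hk, zero_mul, smul_zero]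

/-- every s_{ij} with i > j > i′ lies in the span of ordered products
    s_{i₁a₁} ⋯ s_{i_p a_p} with a_m′ ≥ i_m > a_m and i′ < i₁ < ⋯ < i_p ≤ j′. -/
theorem sij_in_span_of_ordered_products (n : ℕ) (hn : 2 ≤ n)
    (i j : Fin (2*n)) (hji : j < i) (hij : pr n i < j) :
    sU n i j ∈ Submodule.span F
      {x : Usp n | ∃ p : ℕ, 0 < p ∧ ∃ is as : Fin p → Fin (2*n),
        StrictMono is ∧
        (∀ m, pr n i < is m ∧ is m ≤ pr n j) ∧
        (∀ m, is m ≤ pr n (as m) ∧ as m < is m) ∧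
        x = (List.ofFn fun m => sU n (is m) (as m)).prod} := by
  rw [sU_eq]
  exact key (dat n) _ i j rfl hji hij

end CI
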